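/- Let G be a finite cyclic group of order n ≥ 3 generated by r. Suppose π : G → G is a bijection such that the family y_g := π ∘ R_g ∘ π⁻¹ (where R_g is right multiplication by g) satisfies: for all subsets C ⊆ G, {y_g(C) | g ∈ G} = {Cg | g ∈ G}. Then each y_g is a right multiplication by some element of G. -/

import Mathlib

theorem stmt_9 {G : Type*} [Group G] [Fintype G] (n : ℕ) (hn : 3 ≤ n)
    (hcard : Fintype.card G = n) (r : G) (hgen : ∀ x : G, x ∈ Subgroup.zpowers r)
    (π : Equiv.Perm G)
    (horb : ∀ C : Set G,
      {S : Set G | ∃ g : G, S = (π ∘ (· * g) ∘ π.symm) '' C}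
        = {S : Set G | ∃ g : G, S = (· * g) '' C}) :
    ∀ g : G, ∃ c : G, (π ∘ (· * g) ∘ π.symm : G → G) = fun x => x * c := by
  have hpow : ∀ x : G, ∃ k : ℕ, r ^ k = x := fun x => by
    have := mem_powers_iff_mem_zpowers.2 (hgen x)
    exact this
  have hcomm : ∀ a b : G, a * b = b * a := by
    intro a b
    obtain ⟨i, rfl⟩ := hpow a
    obtain ⟨j, rfl⟩ := hpow b
    rw [← pow_add, ← pow_add, add_comm]
  have hr2 : r * r ≠ 1 := by
    intro h
    have h1 : orderOf r = Fintype.card G := by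
      rw [← Nat.card_eq_fintype_card]
      exact orderOf_eq_card_of_forall_mem_zpowers hgen
    have h2 : orderOf r ≤ 2 := orderOf_le_of_pow_eq_one (by norm_num) (by rw [pow_two, h])
    omega
  obtain ⟨Y, hY⟩ : ∃ Y : G → G, ∀ x, Y x = π (π.symm x * r) := ⟨_, fun _ => rfl⟩
  have hYinj : Function.Injective Y := by
    intro a b h
    simpa [hY] using h
  have hr1 : r ≠ 1 := by
    rintro rfl
    simp at hr2
  have hstep : ∀ x, Y (x * r) = Y x * r ∨ Y x = Y (x * r) * r := by
    intro x
    have h1 : (π ∘ (· * r) ∘ π.symm) '' {x, x * r} ∈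
        {S : Set G | ∃ g : G, S = (· * g) '' {x, x * r}} := by
      rw [← horb]
      exact ⟨r, rfl⟩
    obtain ⟨g, hg⟩ := h1
    have hg' : ({Y x, Y (x * r)} : Set G) = {x * g, x * r * g} := by
      simpa [Set.image_pair, hY] using hg
    have e : x * r * g = x * g * r := by rw [mul_assoc, hcomm r g, mul_assoc]
    rw [e] at hg'
    rcases Set.pair_eq_pair_iff.1 hg' with ⟨h1, h2⟩ | ⟨h1, h2⟩
    · left; rw [h1, h2]
    · right; rw [h1, h2]
  have hne : ∀ x, Y (x * r * r) ≠ Y x := by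
    intro x h
    have := hYinj h
    rw [mul_assoc] at this
    exact hr2 (by simpa using this)
  have hrot : ∃ c, ∀ x, Y x = x * c := by
    rcases hstep 1 with h0 | h0
    · have hA : ∀ k : ℕ, Y (r ^ k * r) = Y (r ^ k) * r := by
        intro k
        induction k with
        | zero => simpa using h0
        | succ k ih =>
          rw [pow_succ]
          rcases hstep (r ^ k * r) with h | h
          · exact h
          · exact absurd (mul_right_cancel (h.symm.trans ih)) (hne _)
      refine ⟨Y 1, fun x => ?_⟩
      obtain ⟨k, rfl⟩ := hpow x
      induction k with
      | zero => simp
      | succ k ih => rw [pow_succ, hA, ih, mul_assoc, mul_assoc, hcomm r]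
    · exfalso
      have hA : ∀ k : ℕ, Y (r ^ k) = Y (r ^ k * r) * r := by
        intro k
        induction k with
        | zero => simpa using h0
        | succ k ih =>
          rw [pow_succ]
          rcases hstep (r ^ k * r) with h | h
          · exact absurd (h.trans ih.symm) (hne _)
          · exact h
      have hB : ∀ x, Y x * x = Y 1 := by
        intro x
        obtain ⟨k, rfl⟩ := hpow x
        induction k with
        | zero => simp
        | succ k ih =>
          rw [← ih, hA k, pow_succ, mul_assoc, hcomm r]
      have hC : Y (Y 1) = 1 := by
        have := hB (Y 1)
        simpa using this
      have hD : Y (Y 1) = π (π.symm 1 * r * r) := by simp [hY]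
      rw [hD] at hC
      have h5 : π.symm 1 * r * r = π.symm 1 := by rw [Equiv.eq_symm_apply, hC]
      rw [mul_assoc] at h5
      exact hr2 (by simpa using h5)
  obtain ⟨c, hc⟩ := hrot
  intro g
  obtain ⟨k, rfl⟩ := hpow g
  refine ⟨c ^ k, ?_⟩
  funext x
  simp only [Function.comp]
  induction k with
  | zero => simp
  | succ k ih =>
    have := hc (π (π.symm x * r ^ k))
    rw [hY, Equiv.symm_apply_apply, ih, mul_assoc, mul_assoc, ← pow_succ, ← pow_succ] at this
    exact this
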